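/- arXiv:1407.5128 — 3 statements merged into one kernel-verified Lean document; each statement's English description precedes it below -/
import Mathlib

section
/- Let k ≥ 2 and let CHAIN_k be the chain-of-gadgets graph with input vertices x_0, …, x_{k-1} and output vertex z = y_{k-2}. If c is a proper 3-coloring of CHAIN_k and c assigns all of x_0, …, x_{k-1} the same color, then c assigns the output vertex z that same color. -/
/-- Vertices of the chain graph `CHAIN k`: the left summand gives the input vertices
`x_0, …, x_{k-1}`; for `j : Fin (k-1)` the right summand gives `a_j = (j, 0)`,
`b_j = (j, 1)` and the outputs `y_j = (j, 2)`. -/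
abbrev ChainVert (k : ℕ) := Fin k ⊕ Fin (k - 1) × Fin 3

/-- The input of the `j`-th gadget: `in_0 = x_0` and `in_j = y_{j-1}` for `j ≥ 1`. -/
def chainIn (k : ℕ) (j : Fin (k - 1)) : ChainVert k :=
  if _ : j.1 = 0 then Sum.inl ⟨0, by have := j.2; omega⟩
  else Sum.inr (⟨j.1 - 1, by have := j.2; omega⟩, 2)

/-- The chain graph `CHAIN k = GAD(x_0, …, x_{k-1}, z)`: for each `j : Fin (k-1)` it has
the gadget edges `{in_j, a_j}, {x_{j+1}, b_j}, {a_j, b_j}, {a_j, y_j}, {b_j, y_j}`. -/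
def CHAIN (k : ℕ) : SimpleGraph (ChainVert k) :=
  SimpleGraph.fromEdgeSet (⋃ j : Fin (k - 1),
    {s(chainIn k j, Sum.inr (j, 0)),
     s(Sum.inl ⟨j.1 + 1, by have := j.2; omega⟩, Sum.inr (j, 1)),
     s(Sum.inr (j, 0), Sum.inr (j, 1)),
     s(Sum.inr (j, 0), Sum.inr (j, 2)),
     s(Sum.inr (j, 1), Sum.inr (j, 2))})

/-- If a proper 3-coloring of `CHAIN k` (`k ≥ 2`) gives all the inputs
`x_0, …, x_{k-1}` the same color, then the output `z = y_{k-2}` gets that color. -/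
theorem chain_forces_output (k : ℕ) (hk : 2 ≤ k) (c : (CHAIN k).Coloring (Fin 3))
    (h : ∀ i i' : Fin k, c (Sum.inl i) = c (Sum.inl i')) :
    c (Sum.inr (⟨k - 2, by omega⟩, 2)) = c (Sum.inl ⟨0, by omega⟩) := by
  have adj : ∀ (j : Fin (k - 1)) (u v : ChainVert k), u ≠ v →
      s(u, v) ∈ ({s(chainIn k j, Sum.inr (j, 0)),
        s(Sum.inl ⟨j.1 + 1, by have := j.2; omega⟩, Sum.inr (j, 1)),
        s(Sum.inr (j, 0), Sum.inr (j, 1)),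
        s(Sum.inr (j, 0), Sum.inr (j, 2)),
        s(Sum.inr (j, 1), Sum.inr (j, 2))} : Set (Sym2 (ChainVert k))) → c u ≠ c v := by
    intro j u v huv hm
    apply c.valid
    unfold CHAIN
    rw [SimpleGraph.fromEdgeSet_adj]
    exact ⟨Set.mem_iUnion.2 ⟨j, hm⟩, huv⟩
  have key : ∀ p q a b y : Fin 3, p = q → p ≠ a → q ≠ b → a ≠ b → a ≠ y → b ≠ y → y = q := by
    intro p q a b y
    omega
  have step : ∀ j : Fin (k - 1), c (chainIn k j) = c (Sum.inl ⟨0, by omega⟩) →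
      c (Sum.inr (j, 2)) = c (Sum.inl ⟨0, by omega⟩) := by
    intro j hj
    have hx := h ⟨j.1 + 1, by have := j.2; omega⟩ ⟨0, by omega⟩
    rw [← hx] at hj ⊢
    refine key _ _ (c (Sum.inr (j, 0))) (c (Sum.inr (j, 1))) _ hj ?_ ?_ ?_ ?_ ?_
    · refine adj j _ _ ?_ (by simp)
      unfold chainIn
      split <;> simp
    all_goals exact adj j _ _ (by simp) (by simp)
  have all : ∀ (n : ℕ) (hn : n < k - 1),
      c (Sum.inr (⟨n, hn⟩, 2)) = c (Sum.inl ⟨0, by omega⟩) := by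
    intro n
    induction n with
    | zero =>
      intro hn
      apply step
      simp [chainIn]
    | succ m ih =>
      intro hn
      apply step
      have := ih (by omega)
      simpa [chainIn] using this
  exact all _ _
end

section
/- Let k ≥ 2 and let CHAIN_k be the chain-of-gadgets graph with input vertices x_0, …, x_{k-1} and output vertex z = y_{k-2}. For any assignment of colors c_0, …, c_{k-1} ∈ Fin 3 to the input vertices and any target color t ∈ Fin 3 such that (if all of c_0, …, c_{k-1} are equal to some common value a, then t = a), there exists a proper 3-coloring c of CHAIN_k with c(x_i) = c_i for all i and c(z) = t. -/
theorem gad_aux : ∀ x y z : Fin 3, (x = y → z = x) →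
    ∃ p : Fin 3 × Fin 3, p.1 ≠ x ∧ p.2 ≠ y ∧ p.1 ≠ p.2 ∧ p.1 ≠ z ∧ p.2 ≠ z := by decide

theorem seq_aux (c : ℕ → Fin 3) (n : ℕ) : ∀ t : Fin 3,
    (∀ a, (∀ i, i ≤ n → c i = a) → t = a) →
    ∃ w : ℕ → Fin 3, w 0 = c 0 ∧ w n = t ∧ ∀ j, j < n → (w j = c (j+1) → w (j+1) = w j) := by
  induction n with
  | zero =>
    intro t ht
    refine ⟨fun _ => t, ?_, rfl, by intro j hj; omega⟩
    exact ht (c 0) (by intro i hi; rw [Nat.le_zero.mp hi])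
  | succ n ih =>
    intro t ht
    have key : ∃ s, (∀ a, (∀ i, i ≤ n → c i = a) → s = a) ∧ (s = c (n+1) → t = s) := by
      by_cases h1 : t = c (n+1)
      · exact ⟨c 0, fun a ha => ha 0 (Nat.zero_le _), fun h => h1.trans h.symm⟩
      · by_cases h2 : ∃ a, ∀ i, i ≤ n → c i = a
        · obtain ⟨a, ha⟩ := h2
          refine ⟨a, fun b hb => (ha 0 (Nat.zero_le _)).symm.trans (hb 0 (Nat.zero_le _)), ?_⟩
          intro h
          apply ht
          intro i hi
          rcases Nat.le_succ_iff.mp hi with h' | h'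
          · exact ha i h'
          · rw [h']; exact h.symm
        · exact ⟨t, fun a ha => (h2 ⟨a, ha⟩).elim, fun _ => rfl⟩
    obtain ⟨s, hs, hst⟩ := key
    obtain ⟨w, h0, hn, hw⟩ := ih s hs
    refine ⟨fun j => if j ≤ n then w j else t, by simpa using h0, by simp, ?_⟩
    intro j hj
    by_cases hjn : j = n
    · subst hjn
      simpa [hn] using hst
    · have h1 : j ≤ n := by omega
      have h2 : j + 1 ≤ n := by omega
      simpa [h1, h2] using hw j (by omega)

/-- Given colors `cs 0, …, cs (k-1)` for the inputs and a target color `t` for the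
output such that `t` equals the common color whenever all input colors agree, there is a
proper 3-coloring of `CHAIN k` realizing these colors on the inputs and on `z = y_{k-2}`. -/
theorem chain_realizable (k : ℕ) (hk : 2 ≤ k) (cs : Fin k → Fin 3) (t : Fin 3)
    (h : ∀ a : Fin 3, (∀ i, cs i = a) → t = a) :
    ∃ c : (CHAIN k).Coloring (Fin 3),
      (∀ i, c (Sum.inl i) = cs i) ∧ c (Sum.inr (⟨k - 2, by omega⟩, 2)) = t := by
  have hk0 : 0 < k := by omega
  obtain ⟨w, h0, hn, hw⟩ := seq_aux (fun i => if hi : i < k then cs ⟨i, hi⟩ else 0) (k - 1) t (by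
    intro a ha
    apply h
    intro i
    have := ha i.1 (by omega)
    simpa using this)
  have hg : ∀ j : Fin (k - 1), ∃ p : Fin 3 × Fin 3, p.1 ≠ w j ∧
      p.2 ≠ cs ⟨j.1 + 1, by have := j.2; omega⟩ ∧ p.1 ≠ p.2 ∧ p.1 ≠ w (j+1) ∧ p.2 ≠ w (j+1) := by
    intro j
    apply gad_aux
    have h1 : j.1 + 1 < k := by have := j.2; omega
    simpa [h1] using hw j j.2
  choose p hp using hg
  let f : ChainVert k → Fin 3 := Sum.elim cs (fun q => ![(p q.1).1, (p q.1).2, w (q.1 + 1)] q.2)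
  have hin : ∀ j, f (chainIn k j) = w j := by
    intro j
    unfold chainIn
    split_ifs with hj
    · simp [f, hj, h0, hk0]
    · have : j.1 - 1 + 1 = j.1 := by omega
      simp [f, this]
  have hf : ∀ u v, (CHAIN k).Adj u v → f u ≠ f v := by
    intro u v huv
    rw [CHAIN, SimpleGraph.fromEdgeSet_adj] at huv
    obtain ⟨hm, -⟩ := huv
    obtain ⟨j, hj⟩ := Set.mem_iUnion.mp hm
    obtain ⟨h1, h2, h3, h4, h5⟩ := hp j
    simp only [Set.mem_insert_iff, Set.mem_singleton_iff, Sym2.eq_iff] at hj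
    have e0 : f (Sum.inr (j, 0)) = (p j).1 := rfl
    have e1 : f (Sum.inr (j, 1)) = (p j).2 := rfl
    have e2 : f (Sum.inr (j, 2)) = w (j + 1) := rfl
    have e3 : ∀ i, f (Sum.inl i) = cs i := fun _ => rfl
    have e4 := hin j
    rcases hj with (⟨rfl, rfl⟩ | ⟨rfl, rfl⟩) | (⟨rfl, rfl⟩ | ⟨rfl, rfl⟩) |
      (⟨rfl, rfl⟩ | ⟨rfl, rfl⟩) | (⟨rfl, rfl⟩ | ⟨rfl, rfl⟩) | (⟨rfl, rfl⟩ | ⟨rfl, rfl⟩) <;>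
    simp only [e0, e1, e2, e3, e4] <;> first | assumption | (apply Ne.symm; assumption)
  refine ⟨SimpleGraph.Coloring.mk f (fun {u v} huv => hf u v huv), fun _ => rfl, ?_⟩
  change w (k - 2 + 1) = t
  rw [← hn]
  congr 1
  omega
end

section
/- Let a ≤ b be natural numbers and let G be a simple graph on a vertex type V. Let J be the join of G with the complete graph on Fin (b − a): the simple graph on V ⊕ Fin (b − a) in which two vertices of V are adjacent iff they are adjacent in G, any two distinct vertices of Fin (b − a) are adjacent, and every vertex of V is adjacent to every vertex of Fin (b − a). Then G is a-colorable if and only if J is b-colorable. -/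
/-- The join of `G` with the complete graph on `Fin m`: two left vertices are adjacent
iff they are adjacent in `G`, two right vertices are adjacent iff they are distinct,
and every left vertex is adjacent to every right vertex. -/
def joinComplete {V : Type*} (G : SimpleGraph V) (m : ℕ) : SimpleGraph (V ⊕ Fin m) where
  Adj x y :=
    match x, y with
    | Sum.inl u, Sum.inl v => G.Adj u v
    | Sum.inr i, Sum.inr j => i ≠ j
    | Sum.inl _, Sum.inr _ => True
    | Sum.inr _, Sum.inl _ => True
  symm := by
    refine ⟨?_⟩
    rintro (u | i) (v | j) h
    · exact G.symm.symm _ _ h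
    · trivial
    · trivial
    · exact Ne.symm h
  loopless := by
    refine ⟨?_⟩
    rintro (u | i) h
    · exact G.loopless.irrefl u h
    · exact h rfl

/-- For `a ≤ b`, a simple graph `G` is `a`-colorable iff the join of `G` with the
complete graph on `b - a` vertices is `b`-colorable. -/
theorem colorable_iff_join_complete_colorable (a b : ℕ) (hab : a ≤ b)
    {V : Type*} (G : SimpleGraph V) :
    G.Colorable a ↔ (joinComplete G (b - a)).Colorable b := by
  classical
  constructor
  · rintro ⟨C⟩
    let D : (joinComplete G (b - a)).Coloring (Fin a ⊕ Fin (b - a)) :=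
      SimpleGraph.Coloring.mk (Sum.map C id) (by
        rintro (u | i) (v | j) h
        · intro e
          exact C.valid h (Sum.inl.inj e)
        · intro e
          cases e
        · intro e
          cases e
        · intro e
          exact h (Sum.inr.inj e))
    have hD := D.colorable
    have hc : Fintype.card (Fin a ⊕ Fin (b - a)) = b := by
      simp only [Fintype.card_sum, Fintype.card_fin]
      omega
    rwa [hc] at hD
  · rintro ⟨C⟩
    let f : Fin (b - a) → Fin b := fun i => C (Sum.inr i)
    have hf : Function.Injective f := by
      intro i j e
      by_contra hij
      exact C.valid (v := Sum.inr i) (w := Sum.inr j) hij e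
    let D : G.Coloring {c : Fin b // ¬ c ∈ Finset.univ.image f} :=
      SimpleGraph.Coloring.mk (fun v => ⟨C (Sum.inl v), by
        intro h
        obtain ⟨i, -, hi⟩ := Finset.mem_image.1 h
        exact C.valid (v := Sum.inr i) (w := Sum.inl v) trivial hi⟩) (by
        intro u v h e
        exact C.valid (v := Sum.inl u) (w := Sum.inl v) h (congrArg Subtype.val e))
    have hD := D.colorable
    have hc : Fintype.card {c : Fin b // ¬ c ∈ Finset.univ.image f} = a := by
      rw [Fintype.card_subtype_compl, Fintype.card_coe, Finset.card_image_of_injective _ hf,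
        Finset.card_univ, Fintype.card_fin, Fintype.card_fin]
      omega
    rwa [hc] at hD
end
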